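/- The finite derivative test D is error-free: for all probability measures f, g on Ω^∞, every ε ∈ (0,1/2) and every measurable set A ⊆ Ω^∞, f(A ∩ R_{D,ε}^{(f,g)}) ≤ (ε/(1−ε))·g(A ∩ R_{D,ε}^{(f,g)}); and for every ε ∈ (1/2,1) and every measurable set A, g(A ∩ L_{D,ε}^{(f,g)}) ≤ ((1−ε)/ε)·f(A ∩ L_{D,ε}^{(f,g)}). -/

import Mathlib

open MeasureTheory Filter Set
open scoped ENNReal

/-- The space Ω^∞ of infinite binary sequences. -/
abbrev BinSeq : Type := ℕ → Bool

/-- The cylinder set `[ω^t]` of sequences agreeing with `ω` in the first `t` coordinates. -/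
def cyl (ω : BinSeq) (t : ℕ) : Set BinSeq := {ω' | ∀ i < t, ω' i = ω i}

/-- A (candidate) cardinal comparison test: to each ordered pair of measures, each time `t`
and each realization `ω` it assigns a number. -/
abbrev Test : Type := Measure BinSeq → Measure BinSeq → ℕ → BinSeq → ℝ

/-- The σ-algebra on `BinSeq` generated by the first `t` coordinates. -/
def coordAlg (t : ℕ) : MeasurableSpace BinSeq :=
  MeasurableSpace.comap (fun ω (i : Fin t) => ω (i : ℕ)) inferInstance

/-- A cardinal comparison test: values in `[0,1]`, and `T_t` is measurable with respect to the
σ-algebra generated by the first `t` coordinates, for every `t ≥ 1`. -/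
def IsCCTest (T : Test) : Prop :=
  ∀ f g : Measure BinSeq, IsProbabilityMeasure f → IsProbabilityMeasure g →
    ∀ t : ℕ, 1 ≤ t →
      (∀ ω, T f g t ω ∈ Set.Icc (0:ℝ) 1) ∧ @Measurable BinSeq ℝ (coordAlg t) _ (T f g t)

/-- `L_{T,ε}^{(f,g)}`: the set of `ω` where `lim_t T_t(ω,f,g)` exists and is `> ε`. -/
def LSet (T : Test) (f g : Measure BinSeq) (ε : ℝ) : Set BinSeq :=
  {ω | ∃ l : ℝ, Tendsto (fun t => T f g t ω) atTop (nhds l) ∧ ε < l}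

/-- `R_{T,ε}^{(f,g)}`: the set of `ω` where `lim_t T_t(ω,f,g)` exists and is `< ε`. -/
def RSet (T : Test) (f g : Measure BinSeq) (ε : ℝ) : Set BinSeq :=
  {ω | ∃ l : ℝ, Tendsto (fun t => T f g t ω) atTop (nhds l) ∧ l < ε}

/-- Anonymity: `T_t(ω,f,g) = 1 - T_t(ω,g,f)`. -/
def Anonymous (T : Test) : Prop :=
  ∀ f g : Measure BinSeq, IsProbabilityMeasure f → IsProbabilityMeasure g →
    ∀ t : ℕ, 1 ≤ t → ∀ ω, T f g t ω = 1 - T g f t ω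

/-- Error-freeness. -/
def ErrorFree (T : Test) : Prop :=
  ∀ f g : Measure BinSeq, IsProbabilityMeasure f → IsProbabilityMeasure g →
    ∀ A : Set BinSeq, MeasurableSet A →
      (∀ ε : ℝ, ε ∈ Set.Ioo 0 (1/2) →
        f (A ∩ RSet T f g ε) ≤ ENNReal.ofReal (ε / (1 - ε)) * g (A ∩ RSet T f g ε)) ∧
      (∀ ε : ℝ, ε ∈ Set.Ioo (1/2) 1 →
        g (A ∩ LSet T f g ε) ≤ ENNReal.ofReal ((1 - ε) / ε) * f (A ∩ LSet T f g ε))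

/-- Reasonableness. -/
def Reasonable (T : Test) : Prop :=
  ∀ f g : Measure BinSeq, IsProbabilityMeasure f → IsProbabilityMeasure g →
    ∀ A : Set BinSeq, MeasurableSet A →
      (∀ ε : ℝ, ε ∈ Set.Ioo 0 (1/2) →
        0 < g A → f A < ENNReal.ofReal (ε / (1 - ε)) * g A →
          0 < g (A ∩ RSet T f g ε)) ∧
      (∀ ε : ℝ, ε ∈ Set.Ioo (1/2) 1 →
        0 < f A → g A < ENNReal.ofReal ((1 - ε) / ε) * f A →
          0 < f (A ∩ LSet T f g ε))

/-- The finite derivative test `D`. -/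
noncomputable def Dtest : Test := fun f g t ω =>
  match t with
  | 0 => 1/2
  | Nat.succ s =>
      if 0 < f (cyl ω s) + g (cyl ω s) then
        (f (cyl ω s)).toReal / ((f (cyl ω s)).toReal + (g (cyl ω s)).toReal)
      else 1/2


theorem isOpen_cyl (ω : BinSeq) (t : ℕ) : IsOpen (cyl ω t) :=
  PiNat.isOpen_cylinder (fun _ => Bool) ω t

theorem mem_cyl_self (ω : BinSeq) (t : ℕ) : ω ∈ cyl ω t := fun _ _ => rfl

theorem cyl_eq_of_mem {ω η : BinSeq} {t : ℕ} (h : η ∈ cyl ω t) : cyl η t = cyl ω t :=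
  PiNat.mem_cylinder_iff_eq.1 h

theorem cyl_anti (ω : BinSeq) {s t : ℕ} (h : s ≤ t) : cyl ω t ⊆ cyl ω s :=
  fun _ hη i hi => hη i (hi.trans_le h)

theorem eventually_cyl_subset {U : Set BinSeq} (hU : IsOpen U) {ω : BinSeq} (hω : ω ∈ U) :
    ∀ᶠ t in atTop, cyl ω t ⊆ U := by
  obtain ⟨_, ⟨η, n, rfl⟩, hωη, hsub⟩ :=
    (PiNat.isTopologicalBasis_cylinders (fun _ => Bool)).exists_subset_of_mem_open hω hU
  filter_upwards [eventually_ge_atTop n] with t ht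
  exact (cyl_anti ω ht).trans ((cyl_eq_of_mem hωη).trans_subset hsub)

/-- Vitali-type comparison: if every point of an arbitrary set `S` has arbitrarily small cylinders
with `f`-mass at most `c` times the `g`-mass, then the same bound holds for `S`. -/
theorem measure_le_mul_of_frequently_cyl {f g : Measure BinSeq} [IsFiniteMeasure g] {c : ℝ≥0∞}
    (hc : c ≠ ∞) {S : Set BinSeq}
    (hS : ∀ ω ∈ S, ∃ᶠ t in atTop, f (cyl ω t) ≤ c * g (cyl ω t)) : f S ≤ c * g S := by
  classical
  have key : ∀ U, IsOpen U → S ⊆ U → f S ≤ c * g U := by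
    intro U hU hSU
    let P : BinSeq → ℕ → Prop := fun ω t => cyl ω t ⊆ U ∧ f (cyl ω t) ≤ c * g (cyl ω t)
    have hP : ∀ ω ∈ S, ∃ t, P ω t := fun ω hω =>
      ((hS ω hω).and_eventually (eventually_cyl_subset hU (hSU hω))).exists.imp
        fun t h => ⟨h.2, h.1⟩
    let 𝒞 : Set (Set BinSeq) := {C | ∃ ω t, P ω t ∧ (∀ s < t, ¬ P ω s) ∧ C = cyl ω t}
    have hcover : S ⊆ ⋃₀ 𝒞 := fun ω hω =>
      ⟨_, ⟨ω, Nat.find (hP ω hω), Nat.find_spec (hP ω hω), fun _ => Nat.find_min (hP ω hω), rfl⟩,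
        mem_cyl_self _ _⟩
    have hopen : ∀ C ∈ 𝒞, IsOpen C := by
      rintro _ ⟨ω, t, -, -, rfl⟩
      exact isOpen_cyl ω t
    have hdisj : 𝒞.PairwiseDisjoint id := by
      rintro _ ⟨ω, t, hωt, hmin, rfl⟩ _ ⟨η, s, hηs, hmin', rfl⟩ hne
      refine Set.disjoint_left.2 fun x hx hy => hne ?_
      have hx' : x ∈ cyl ω t := hx
      have hy' : x ∈ cyl η s := hy
      rcases lt_trichotomy t s with h | rfl | h
      · have e := (cyl_eq_of_mem hx').symm.trans (cyl_eq_of_mem (cyl_anti η h.le hy'))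
        exact (hmin' t h (by simpa only [P, e] using hωt)).elim
      · exact (cyl_eq_of_mem hx').symm.trans (cyl_eq_of_mem hy')
      · have e := (cyl_eq_of_mem hy').symm.trans (cyl_eq_of_mem (cyl_anti ω h.le hx'))
        exact (hmin s h (by simpa only [P, e] using hηs)).elim
    have hcount : 𝒞.Countable := hdisj.countable_of_isOpen hopen <| by
      rintro _ ⟨ω, t, -, -, rfl⟩
      exact ⟨ω, mem_cyl_self ω t⟩
    have hmeas : ∀ C ∈ 𝒞, MeasurableSet C := fun C hC => (hopen C hC).measurableSet
    calc f S ≤ f (⋃₀ 𝒞) := measure_mono hcover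
      _ = ∑' C : 𝒞, f C := measure_sUnion hcount hdisj hmeas
      _ ≤ ∑' C : 𝒞, c * g C := by
        refine ENNReal.tsum_le_tsum ?_
        rintro ⟨_, ω, t, h, -, rfl⟩
        exact h.2
      _ = c * g (⋃₀ 𝒞) := by rw [ENNReal.tsum_mul_left, measure_sUnion hcount hdisj hmeas]
      _ ≤ c * g U := by
        gcongr
        refine sUnion_subset ?_
        rintro _ ⟨ω, t, h, -, rfl⟩
        exact h.1
  refine ENNReal.le_of_forall_pos_le_add fun δ hδ _ => ?_
  have hδc : (δ : ℝ≥0∞) / c ≠ 0 := ENNReal.div_ne_zero.2 ⟨by exact_mod_cast hδ.ne', hc⟩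
  obtain ⟨U, hSU, hU, hgU⟩ := S.exists_isOpen_le_add g hδc
  calc f S ≤ c * g U := key U hU hSU
    _ ≤ c * (g S + δ / c) := by gcongr
    _ ≤ c * g S + δ := by
      rw [mul_add]
      gcongr
      exact ENNReal.mul_div_le

theorem measure_le_ofReal_div_mul {f g : Measure BinSeq} [IsFiniteMeasure f] [IsFiniteMeasure g]
    {a b : ℝ} (ha : 0 ≤ a) (hb : 0 < b) {C : Set BinSeq}
    (h : b * (f C).toReal ≤ a * (g C).toReal) : f C ≤ ENNReal.ofReal (a / b) * g C := by
  rw [← ENNReal.ofReal_toReal (measure_ne_top f C), ← ENNReal.ofReal_toReal (measure_ne_top g C),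
    ← ENNReal.ofReal_mul (by positivity)]
  refine ENNReal.ofReal_le_ofReal ?_
  rw [div_mul_eq_mul_div, le_div_iff₀ hb]
  linarith

theorem Dtest_succ_eq_half_or (f g : Measure BinSeq) [IsFiniteMeasure f] [IsFiniteMeasure g]
    (t : ℕ) (ω : BinSeq) :
    Dtest f g (t + 1) ω = 1 / 2 ∨
      0 < (f (cyl ω t)).toReal + (g (cyl ω t)).toReal ∧ Dtest f g (t + 1) ω =
        (f (cyl ω t)).toReal / ((f (cyl ω t)).toReal + (g (cyl ω t)).toReal) := by
  by_cases h : 0 < f (cyl ω t) + g (cyl ω t)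
  · refine Or.inr ⟨?_, if_pos h⟩
    rw [← ENNReal.toReal_add (measure_ne_top _ _) (measure_ne_top _ _)]
    exact ENNReal.toReal_pos h.ne' (by finiteness)
  · exact Or.inl (if_neg h)

/-- The finite derivative test is error-free. -/
theorem stmt1 : ErrorFree Dtest := by
  intro f g _ _ A _
  refine ⟨fun ε ⟨hε, hε'⟩ => ?_, fun ε ⟨hε, hε'⟩ => ?_⟩
  · refine measure_le_mul_of_frequently_cyl ENNReal.ofReal_ne_top ?_
    rintro ω ⟨-, l, hl, hlε⟩
    refine (((tendsto_add_atTop_iff_nat 1).2 hl).eventually_lt_const hlε).frequently.mono ?_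
    intro t ht
    refine measure_le_ofReal_div_mul hε.le (by linarith) ?_
    rcases Dtest_succ_eq_half_or f g t ω with h | ⟨hpos, h⟩
    · linarith
    · rw [h, div_lt_iff₀ hpos] at ht
      linarith
  · refine measure_le_mul_of_frequently_cyl ENNReal.ofReal_ne_top ?_
    rintro ω ⟨-, l, hl, hlε⟩
    refine (((tendsto_add_atTop_iff_nat 1).2 hl).eventually_const_lt hlε).frequently.mono ?_
    intro t ht
    refine measure_le_ofReal_div_mul (by linarith) (by linarith) ?_
    rcases Dtest_succ_eq_half_or f g t ω with h | ⟨hpos, h⟩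
    · linarith
    · rw [h, lt_div_iff₀ hpos] at ht
      linarith
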